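/- Holonomy is compatible with horizontal composition (trivialized form): let C, E be real Banach spaces and ∂ : C → E a continuous linear map. Let S = (A^C, A^E, B^C, B^E, Ω, P^C, P^E) and S' = (A'^C, A'^E, B'^C, B'^E, Ω', P'^C, P'^E) be two systems, each consisting of continuous maps A^C, B^C : ℝ × ℝ → L(C,C), A^E, B^E : ℝ × ℝ → L(E,E), Ω : ℝ × ℝ → L(E,C) with jointly continuous partial derivatives ∂_sA^C, ∂_sA^E, ∂_tB^C, ∂_tB^E, together with s-differentiable propagators P^C for A^C and P^E for A^E, and each satisfying: the intertwining relations ∂ ∘ A^C = A^E ∘ ∂ and ∂ ∘ B^C = B^E ∘ ∂ pointwise; the curvature relations ∂ ∘ Ω(t,s) = F^E(t,s) and Ω(t,s) ∘ ∂ = F^C(t,s), where F^X := ∂_sA^X − ∂_tB^X + A^X ∘ B^X − B^X ∘ A^X; and the boundary conditions B^C(0,s) = B^C(1,s) = 0, B^E(0,s) = B^E(1,s) = 0 for s ∈ [0,1] (and likewise for S'). Define hol(S) := ∫₀¹ ∫₀¹ P^C(1,t;s) ∘ Ω(t,s) ∘ P^E(t,0;s) dt ds and hol(S') analogously. Then ∫₀¹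 ∫₀¹ P'^C(1,0;s) ∘ P^C(1,t;s) ∘ Ω(t,s) ∘ P^E(t,0;s) dt ds + ∫₀¹ ∫₀¹ P'^C(1,t;s) ∘ Ω'(t,s) ∘ P'^E(t,0;s) ∘ P^E(1,0;s) dt ds = P'^C(1,0;0) ∘ hol(S) + hol(S') ∘ P^E(1,0;1). -/

import Mathlib

/-- A "system" as in STATEMENT 11: the trivialized data of a 2-term representation up to
homotopy pulled back along a homotopy of paths, consisting of continuous families
`A^C, B^C` of endomorphisms of `C`, `A^E, B^E` of endomorphisms of `E`, a continuous
family `Ω` of maps `E → C`, jointly continuous partial derivatives `∂ₛA^C, ∂ₛA^E`,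
`∂ₜB^C, ∂ₜB^E`, together with `s`-differentiable propagators `P^C` for `A^C` and `P^E`
for `A^E`, satisfying the intertwining relations, the curvature relations and the
boundary conditions. -/
structure HolonomySystem (C E : Type*)
    [NormedAddCommGroup C] [NormedSpace ℝ C] [CompleteSpace C]
    [NormedAddCommGroup E] [NormedSpace ℝ E] [CompleteSpace E]
    (d : C →L[ℝ] E) where
  AC : ℝ → ℝ → C →L[ℝ] C
  BC : ℝ → ℝ → C →L[ℝ] C
  AE : ℝ → ℝ → E →L[ℝ] E
  BE : ℝ → ℝ → E →L[ℝ] E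
  Om : ℝ → ℝ → E →L[ℝ] C
  hAC : Continuous fun p : ℝ × ℝ => AC p.1 p.2
  hBC : Continuous fun p : ℝ × ℝ => BC p.1 p.2
  hAE : Continuous fun p : ℝ × ℝ => AE p.1 p.2
  hBE : Continuous fun p : ℝ × ℝ => BE p.1 p.2
  hOm : Continuous fun p : ℝ × ℝ => Om p.1 p.2
  AsC : ℝ → ℝ → C →L[ℝ] C
  hAsC : ∀ t s, HasDerivAt (fun u => AC t u) (AsC t s) s
  hAsCcont : Continuous fun p : ℝ × ℝ => AsC p.1 p.2
  AsE : ℝ → ℝ → E →L[ℝ] E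
  hAsE : ∀ t s, HasDerivAt (fun u => AE t u) (AsE t s) s
  hAsEcont : Continuous fun p : ℝ × ℝ => AsE p.1 p.2
  BtC : ℝ → ℝ → C →L[ℝ] C
  hBtC : ∀ t s, HasDerivAt (fun u => BC u s) (BtC t s) t
  hBtCcont : Continuous fun p : ℝ × ℝ => BtC p.1 p.2
  BtE : ℝ → ℝ → E →L[ℝ] E
  hBtE : ∀ t s, HasDerivAt (fun u => BE u s) (BtE t s) t
  hBtEcont : Continuous fun p : ℝ × ℝ => BtE p.1 p.2
  PC : ℝ → ℝ → ℝ → C →L[ℝ] C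
  hPCid : ∀ t s, PC t t s = ContinuousLinearMap.id ℝ C
  hPCcomp : ∀ t'' t' t s, (PC t'' t' s).comp (PC t' t s) = PC t'' t s
  hPCderiv : ∀ t' t s, HasDerivAt (fun u => PC u t s) ((AC t' s).comp (PC t' t s)) t'
  PsC : ℝ → ℝ → ℝ → C →L[ℝ] C
  hPsC : ∀ t' t s, HasDerivAt (fun u => PC t' t u) (PsC t' t s) s
  hPsCcont : Continuous fun p : ℝ × ℝ × ℝ => PsC p.1 p.2.1 p.2.2
  PE : ℝ → ℝ → ℝ → E →L[ℝ] E
  hPEid : ∀ t s, PE t t s = ContinuousLinearMap.id ℝ E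
  hPEcomp : ∀ t'' t' t s, (PE t'' t' s).comp (PE t' t s) = PE t'' t s
  hPEderiv : ∀ t' t s, HasDerivAt (fun u => PE u t s) ((AE t' s).comp (PE t' t s)) t'
  PsE : ℝ → ℝ → ℝ → E →L[ℝ] E
  hPsE : ∀ t' t s, HasDerivAt (fun u => PE t' t u) (PsE t' t s) s
  hPsEcont : Continuous fun p : ℝ × ℝ × ℝ => PsE p.1 p.2.1 p.2.2
  hintA : ∀ t s, d.comp (AC t s) = (AE t s).comp d
  hintB : ∀ t s, d.comp (BC t s) = (BE t s).comp d
  hcurvE : ∀ t s, d.comp (Om t s) =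
    AsE t s - BtE t s + (AE t s).comp (BE t s) - (BE t s).comp (AE t s)
  hcurvC : ∀ t s, (Om t s).comp d =
    AsC t s - BtC t s + (AC t s).comp (BC t s) - (BC t s).comp (AC t s)
  hBC0 : ∀ s ∈ Set.Icc (0:ℝ) 1, BC 0 s = 0
  hBC1 : ∀ s ∈ Set.Icc (0:ℝ) 1, BC 1 s = 0
  hBE0 : ∀ s ∈ Set.Icc (0:ℝ) 1, BE 0 s = 0
  hBE1 : ∀ s ∈ Set.Icc (0:ℝ) 1, BE 1 s = 0

/-- The holonomy `hol(S) = ∫₀¹∫₀¹ P^C(1,t;s) ∘ Ω(t,s) ∘ P^E(t,0;s) dt ds` of a system. -/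
noncomputable def HolonomySystem.hol {C E : Type*}
    [NormedAddCommGroup C] [NormedSpace ℝ C] [CompleteSpace C]
    [NormedAddCommGroup E] [NormedSpace ℝ E] [CompleteSpace E]
    {d : C →L[ℝ] E} (S : HolonomySystem C E d) : E →L[ℝ] C :=
  ∫ s in (0:ℝ)..1, ∫ t in (0:ℝ)..1, (S.PC 1 t s).comp ((S.Om t s).comp (S.PE t 0 s))

open MeasureTheory intervalIntegral Topology

/-- The derivative of a continuous family may be taken under the integral sign. -/
theorem hasDerivAt_intervalIntegral_of_continuous {F : Type*} [NormedAddCommGroup F]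
    [NormedSpace ℝ F] [CompleteSpace F] {f f' : ℝ → ℝ → F}
    (hf : Continuous fun p : ℝ × ℝ => f p.1 p.2)
    (hf' : Continuous fun p : ℝ × ℝ => f' p.1 p.2)
    (hderiv : ∀ u s, HasDerivAt (fun v => f u v) (f' u s) s) (a b s : ℝ) :
    HasDerivAt (fun v => ∫ u in a..b, f u v) (∫ u in a..b, f' u s) s := by
  have hcont : Continuous fun v => ∫ u in a..b, f' u v :=
    continuous_parametric_intervalIntegral_of_continuous'
      (f := fun v u => f' u v) (hf'.comp continuous_swap) a b
  have hF : ∀ v, ∫ u in a..b, f u v =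
      (∫ u in a..b, f u 0) + ∫ w in (0 : ℝ)..v, ∫ u in a..b, f' u w := by
    intro v
    have hswap : ∫ w in (0 : ℝ)..v, ∫ u in a..b, f' u w =
        ∫ u in a..b, ∫ w in (0 : ℝ)..v, f' u w := by
      refine intervalIntegral_intervalIntegral_swap ?_
      have hc : Continuous (Function.uncurry fun w u => f' u w) := hf'.comp continuous_swap
      exact (hc.continuousOn.integrableOn_compact
        (isCompact_uIcc.prod isCompact_uIcc)).mono_set
          (Set.prod_mono Set.uIoc_subset_uIcc Set.uIoc_subset_uIcc)
    have hftc : ∀ u, ∫ w in (0 : ℝ)..v, f' u w = f u v - f u 0 := fun u =>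
      integral_eq_sub_of_hasDerivAt (fun w _ => hderiv u w)
        ((hf'.comp (Continuous.prodMk_right u)).intervalIntegrable _ _)
    rw [hswap]
    simp_rw [hftc]
    have hint : ∀ w, IntervalIntegrable (fun u => f u w) volume a b := fun w =>
      (hf.comp (Continuous.prodMk_left w)).intervalIntegrable _ _
    rw [integral_sub (hint v) (hint 0)]
    abel
  rw [funext hF]
  exact (hcont.integral_hasStrictDerivAt 0 s).hasDerivAt.const_add _

/-- `P` is an `s`-differentiable propagator for the `s`-differentiable family `A`, with
partial derivatives `P'` and `A'` in the direction of the parameter. -/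
structure IsDiffPropagator {R : Type*} [NormedRing R] [NormedAlgebra ℝ R]
    (A A' : ℝ → ℝ → R) (P P' : ℝ → ℝ → ℝ → R) : Prop where
  continuous_gen : Continuous fun p : ℝ × ℝ => A p.1 p.2
  continuous_gen' : Continuous fun p : ℝ × ℝ => A' p.1 p.2
  hasDerivAt_gen : ∀ t s, HasDerivAt (fun u => A t u) (A' t s) s
  refl : ∀ t s, P t t s = 1
  trans : ∀ t'' t' t s, P t'' t' s * P t' t s = P t'' t s
  hasDerivAt_left : ∀ t' t s, HasDerivAt (fun u => P u t s) (A t' s * P t' t s) t'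
  hasDerivAt_param : ∀ t' t s, HasDerivAt (fun u => P t' t u) (P' t' t s) s
  continuous_param' : Continuous fun p : ℝ × ℝ × ℝ => P' p.1 p.2.1 p.2.2

namespace IsDiffPropagator

variable {R : Type*} [NormedRing R] [NormedAlgebra ℝ R]
  {A A' : ℝ → ℝ → R} {P P' : ℝ → ℝ → ℝ → R}

theorem inverse_eq (h : IsDiffPropagator A A' P P') (t' t s : ℝ) :
    Ring.inverse (P t' t s) = P t t' s :=
  Ring.inverse_unit
    ⟨P t' t s, P t t' s, by rw [h.trans, h.refl], by rw [h.trans, h.refl]⟩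

theorem hasDerivAt_right [CompleteSpace R] (h : IsDiffPropagator A A' P P') (t' t s : ℝ) :
    HasDerivAt (fun u => P t' u s) (-(P t' t s * A t s)) t := by
  let x : Rˣ := ⟨P t t' s, P t' t s, by rw [h.trans, h.refl], by rw [h.trans, h.refl]⟩
  have hx := (hasFDerivAt_ringInverse (𝕜 := ℝ) x).comp_hasDerivAt t (h.hasDerivAt_left t t' s)
  have hfun : (Ring.inverse ∘ fun u => P u t' s) = fun u => P t' u s :=
    funext fun u => h.inverse_eq u t' s
  rw [hfun] at hx
  refine hx.congr_deriv ?_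
  change -(P t' t s * (A t s * P t t' s) * P t' t s) = _
  rw [mul_assoc, mul_assoc (A t s), h.trans, h.refl, mul_one]

theorem continuous_left [CompleteSpace R] (h : IsDiffPropagator A A' P P') :
    Continuous fun p : ℝ × ℝ => P p.1 0 p.2 := by
  have hc : Continuous (Function.uncurry fun (p : ℝ × ℝ) (w : ℝ) => P' p.1 0 w) :=
    h.continuous_param'.comp (f := fun q : (ℝ × ℝ) × ℝ => (q.1.1, (0 : ℝ), q.2)) (by fun_prop)
  have hi : Continuous fun p : ℝ × ℝ => ∫ w in (0 : ℝ)..p.2, P' p.1 0 w :=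
    continuous_parametric_intervalIntegral_of_continuous hc continuous_snd
  have h0 : Continuous fun u => P u 0 0 :=
    continuous_iff_continuousAt.2 fun u => (h.hasDerivAt_left u 0 0).continuousAt
  have heq : (fun p : ℝ × ℝ => P p.1 0 p.2) =
      fun p => P p.1 0 0 + ∫ w in (0 : ℝ)..p.2, P' p.1 0 w := by
    funext p
    rw [integral_eq_sub_of_hasDerivAt (fun w _ => h.hasDerivAt_param p.1 0 w)
      ((hc.comp (Continuous.prodMk_right p)).intervalIntegrable _ _)]
    abel
  rw [heq]
  exact (h0.comp continuous_fst).add hi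

theorem continuous_right [CompleteSpace R] (h : IsDiffPropagator A A' P P') (t' : ℝ) :
    Continuous fun p : ℝ × ℝ => P t' p.1 p.2 := by
  have hinv : Continuous fun p : ℝ × ℝ => P 0 p.1 p.2 := by
    refine continuous_iff_continuousAt.2 fun p => ?_
    let x : Rˣ := ⟨P p.1 0 p.2, P 0 p.1 p.2, by rw [h.trans, h.refl], by rw [h.trans, h.refl]⟩
    have hx : ContinuousAt Ring.inverse (P p.1 0 p.2) := NormedRing.inverse_continuousAt x
    have := ContinuousAt.comp (f := fun p : ℝ × ℝ => P p.1 0 p.2) hx h.continuous_left.continuousAt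
    refine this.congr (Filter.Eventually.of_forall fun q => ?_)
    exact h.inverse_eq q.1 0 q.2
  have h0 : Continuous fun p : ℝ × ℝ => P t' 0 p.2 :=
    h.continuous_left.comp (f := fun p : ℝ × ℝ => (t', p.2)) (by fun_prop)
  exact (h0.mul hinv).congr fun p => h.trans t' 0 p.1 p.2

theorem hasDerivAt_param'_left [CompleteSpace R] (h : IsDiffPropagator A A' P P') (t s : ℝ) :
    HasDerivAt (fun u => P' u 0 s) (A' t s * P t 0 s + A t s * P' t 0 s) t := by
  have hP' : Continuous fun p : ℝ × ℝ => P' p.1 0 p.2 :=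
    h.continuous_param'.comp (f := fun p : ℝ × ℝ => (p.1, (0 : ℝ), p.2)) (by fun_prop)
  have hG := h.continuous_gen.mul h.continuous_left
  have hG' := (h.continuous_gen'.mul h.continuous_left).add (h.continuous_gen.mul hP')
  have heq : ∀ u, P' u 0 s = ∫ r in (0 : ℝ)..u, (A' r s * P r 0 s + A r s * P' r 0 s) := by
    intro u
    have hint := hasDerivAt_intervalIntegral_of_continuous (f := fun r v => A r v * P r 0 v)
      (f' := fun r v => A' r v * P r 0 v + A r v * P' r 0 v) hG hG'
      (fun r v => (h.hasDerivAt_gen r v).mul (h.hasDerivAt_param r 0 v)) 0 u s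
    have hvol : (fun v => ∫ r in (0 : ℝ)..u, A r v * P r 0 v) = fun v => P u 0 v - 1 := by
      funext v
      rw [integral_eq_sub_of_hasDerivAt (fun r _ => h.hasDerivAt_left r 0 v)
        ((hG.comp (Continuous.prodMk_left v)).intervalIntegrable _ _), h.refl]
    rw [hvol] at hint
    exact ((h.hasDerivAt_param u 0 s).sub_const 1).unique hint
  have hc : Continuous fun r => A' r s * P r 0 s + A r s * P' r 0 s :=
    hG'.comp (Continuous.prodMk_left s)
  have := (hc.integral_hasStrictDerivAt 0 t).hasDerivAt
  rwa [← funext heq] at this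

/-- The parameter derivative of a propagator is the integral of the transported curvature. -/
theorem param'_eq_integral_curvature [CompleteSpace R] (h : IsDiffPropagator A A' P P')
    {B B' : ℝ → ℝ → R} (hB : Continuous fun p : ℝ × ℝ => B p.1 p.2)
    (hB' : Continuous fun p : ℝ × ℝ => B' p.1 p.2)
    (hderiv : ∀ t s, HasDerivAt (fun u => B u s) (B' t s) t)
    {s : ℝ} (hB0 : B 0 s = 0) (hB1 : B 1 s = 0) :
    P' 1 0 s = ∫ t in (0 : ℝ)..1,
      P 1 t s * ((A' t s - B' t s + A t s * B t s - B t s * A t s) * P t 0 s) := by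
  have hd : ∀ t, HasDerivAt (fun t => P 1 t s * (P' t 0 s - B t s * P t 0 s))
      (P 1 t s * ((A' t s - B' t s + A t s * B t s - B t s * A t s) * P t 0 s)) t := by
    intro t
    refine ((h.hasDerivAt_right 1 t s).mul ((h.hasDerivAt_param'_left t s).sub
      ((hderiv t s).mul (h.hasDerivAt_left t 0 s)))).congr_deriv ?_
    simp only [Pi.sub_apply, Pi.mul_apply]
    noncomm_ring
  have hc : Continuous fun p : ℝ × ℝ => P 1 p.1 p.2 *
      ((A' p.1 p.2 - B' p.1 p.2 + A p.1 p.2 * B p.1 p.2 - B p.1 p.2 * A p.1 p.2) *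
        P p.1 0 p.2) :=
    (h.continuous_right 1).mul ((((h.continuous_gen'.sub hB').add
      (h.continuous_gen.mul hB)).sub (hB.mul h.continuous_gen)).mul h.continuous_left)
  have h00 : P' 0 0 s = 0 := by
    have := h.hasDerivAt_param 0 0 s
    simp only [h.refl] at this
    exact this.unique (hasDerivAt_const s 1)
  rw [integral_eq_sub_of_hasDerivAt (fun t _ => hd t)
    ((hc.comp (Continuous.prodMk_left s)).intervalIntegrable _ _)]
  simp [hB0, hB1, h00, h.refl]

end IsDiffPropagator

namespace HolonomySystem

variable {C E : Type*} [NormedAddCommGroup C] [NormedSpace ℝ C] [CompleteSpace C]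
  [NormedAddCommGroup E] [NormedSpace ℝ E] [CompleteSpace E] {d : C →L[ℝ] E}

theorem isDiffPropagator_PC (S : HolonomySystem C E d) :
    IsDiffPropagator S.AC S.AsC S.PC S.PsC :=
  ⟨S.hAC, S.hAsCcont, S.hAsC, S.hPCid, S.hPCcomp, S.hPCderiv, S.hPsC, S.hPsCcont⟩

theorem isDiffPropagator_PE (S : HolonomySystem C E d) :
    IsDiffPropagator S.AE S.AsE S.PE S.PsE :=
  ⟨S.hAE, S.hAsEcont, S.hAsE, S.hPEid, S.hPEcomp, S.hPEderiv, S.hPsE, S.hPsEcont⟩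

theorem comp_PC (S : HolonomySystem C E d) (t' t s : ℝ) :
    d.comp (S.PC t' t s) = (S.PE t' t s).comp d := by
  have hd : ∀ u, HasDerivAt (fun u => (S.PE t' u s).comp (d.comp (S.PC u t s))) 0 u := by
    intro u
    convert (S.isDiffPropagator_PE.hasDerivAt_right t' u s).clm_comp
      ((hasDerivAt_const u d).clm_comp (S.hPCderiv u t s)) using 1
    have := S.hintA u s
    rw [← ContinuousLinearMap.comp_assoc d, this]
    ext x
    simp
  have := is_const_of_deriv_eq_zero (fun u => (hd u).differentiableAt) (fun u => (hd u).deriv) t' t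
  simpa [S.hPCid, S.hPEid, ContinuousLinearMap.id_comp, ContinuousLinearMap.comp_id] using this

/-- The holonomy density in the parameter direction. -/
noncomputable def holDensity (S : HolonomySystem C E d) (s : ℝ) : E →L[ℝ] C :=
  ∫ t in (0 : ℝ)..1, (S.PC 1 t s).comp ((S.Om t s).comp (S.PE t 0 s))

theorem continuous_integrand (S : HolonomySystem C E d) :
    Continuous fun p : ℝ × ℝ =>
      (S.PC 1 p.1 p.2).comp ((S.Om p.1 p.2).comp (S.PE p.1 0 p.2)) :=
  (S.isDiffPropagator_PC.continuous_right 1).clm_comp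
    (S.hOm.clm_comp S.isDiffPropagator_PE.continuous_left)

theorem intervalIntegrable_integrand (S : HolonomySystem C E d) (s : ℝ) :
    IntervalIntegrable (fun t => (S.PC 1 t s).comp ((S.Om t s).comp (S.PE t 0 s)))
      volume 0 1 :=
  (S.continuous_integrand.comp (Continuous.prodMk_left s)).intervalIntegrable _ _

theorem continuous_holDensity (S : HolonomySystem C E d) : Continuous S.holDensity :=
  continuous_parametric_intervalIntegral_of_continuous'
    (f := fun s t => (S.PC 1 t s).comp ((S.Om t s).comp (S.PE t 0 s)))
    (S.continuous_integrand.comp continuous_swap) 0 1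

theorem integral_comp_integrand (S : HolonomySystem C E d) {F : Type*} [NormedAddCommGroup F]
    [NormedSpace ℝ F] [CompleteSpace F] (L : C →L[ℝ] F) (s : ℝ) :
    ∫ t in (0 : ℝ)..1, L.comp ((S.PC 1 t s).comp ((S.Om t s).comp (S.PE t 0 s))) =
      L.comp (S.holDensity s) :=
  (ContinuousLinearMap.compL ℝ E C F L).intervalIntegral_comp_comm
    (S.intervalIntegrable_integrand s)

theorem integral_integrand_comp (S : HolonomySystem C E d) {F : Type*} [NormedAddCommGroup F]
    [NormedSpace ℝ F] (L : F →L[ℝ] E) (s : ℝ) :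
    ∫ t in (0 : ℝ)..1, (S.PC 1 t s).comp ((S.Om t s).comp ((S.PE t 0 s).comp L)) =
      (S.holDensity s).comp L :=
  ((ContinuousLinearMap.compL ℝ F E C).flip L).intervalIntegral_comp_comm
    (S.intervalIntegrable_integrand s)

theorem PsE_eq (S : HolonomySystem C E d) {s : ℝ} (hs : s ∈ Set.Icc (0 : ℝ) 1) :
    S.PsE 1 0 s = d.comp (S.holDensity s) := by
  rw [S.isDiffPropagator_PE.param'_eq_integral_curvature S.hBE S.hBtEcont S.hBtE
    (S.hBE0 s hs) (S.hBE1 s hs), ← S.integral_comp_integrand]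
  refine integral_congr fun t _ => ?_
  have hcurv : S.AsE t s - S.BtE t s + S.AE t s * S.BE t s - S.BE t s * S.AE t s =
      d.comp (S.Om t s) := (S.hcurvE t s).symm
  simp only [hcurv]
  rw [← ContinuousLinearMap.comp_assoc d, S.comp_PC]
  rfl

theorem PsC_eq (S : HolonomySystem C E d) {s : ℝ} (hs : s ∈ Set.Icc (0 : ℝ) 1) :
    S.PsC 1 0 s = (S.holDensity s).comp d := by
  rw [S.isDiffPropagator_PC.param'_eq_integral_curvature S.hBC S.hBtCcont S.hBtC
    (S.hBC0 s hs) (S.hBC1 s hs), ← S.integral_integrand_comp]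
  refine integral_congr fun t _ => ?_
  have hcurv : S.AsC t s - S.BtC t s + S.AC t s * S.BC t s - S.BC t s * S.AC t s =
      (S.Om t s).comp d := (S.hcurvC t s).symm
  simp only [hcurv]
  rw [← S.comp_PC]
  rfl

theorem comp_integral_holDensity (S : HolonomySystem C E d) {s : ℝ}
    (hs : s ∈ Set.Icc (0 : ℝ) 1) :
    d.comp (∫ u in (0 : ℝ)..s, S.holDensity u) = S.PE 1 0 s - S.PE 1 0 0 := by
  have hd : ∀ u ∈ Set.uIcc 0 s,
      HasDerivAt (fun v => S.PE 1 0 v) (d.comp (S.holDensity u)) u := by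
    intro u hu
    rw [Set.uIcc_of_le hs.1] at hu
    rw [← S.PsE_eq ⟨hu.1, hu.2.trans hs.2⟩]
    exact S.hPsE 1 0 u
  rw [← integral_eq_sub_of_hasDerivAt hd
    ((continuous_const.clm_comp S.continuous_holDensity).intervalIntegrable _ _)]
  exact ((ContinuousLinearMap.compL ℝ E C E d).intervalIntegral_comp_comm
    (S.continuous_holDensity.intervalIntegrable _ _)).symm

theorem hol_comp (S : HolonomySystem C E d) :
    S.hol.comp d = S.PC 1 0 1 - S.PC 1 0 0 := by
  have hd : ∀ u ∈ Set.uIcc (0 : ℝ) 1,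
      HasDerivAt (fun v => S.PC 1 0 v) ((S.holDensity u).comp d) u := by
    intro u hu
    rw [Set.uIcc_of_le zero_le_one] at hu
    rw [← S.PsC_eq hu]
    exact S.hPsC 1 0 u
  rw [← integral_eq_sub_of_hasDerivAt hd
    ((S.continuous_holDensity.clm_comp continuous_const).intervalIntegrable _ _)]
  exact (((ContinuousLinearMap.compL ℝ C E C).flip d).intervalIntegral_comp_comm
    (S.continuous_holDensity.intervalIntegrable _ _)).symm

end HolonomySystem

/-- compatibility of holonomy with horizontal composition (trivialized
form): for two systems `S`, `S'`,
`∫₀¹∫₀¹ P'^C(1,0;s) ∘ P^C(1,t;s) ∘ Ω(t,s) ∘ P^E(t,0;s) dt ds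
 + ∫₀¹∫₀¹ P'^C(1,t;s) ∘ Ω'(t,s) ∘ P'^E(t,0;s) ∘ P^E(1,0;s) dt ds
 = P'^C(1,0;0) ∘ hol(S) + hol(S') ∘ P^E(1,0;1)`. -/
theorem holonomy_horizontal_composition
    {C E : Type*} [NormedAddCommGroup C] [NormedSpace ℝ C] [CompleteSpace C]
    [NormedAddCommGroup E] [NormedSpace ℝ E] [CompleteSpace E]
    (d : C →L[ℝ] E) (S S' : HolonomySystem C E d) :
    (∫ s in (0:ℝ)..1, ∫ t in (0:ℝ)..1,
        (S'.PC 1 0 s).comp ((S.PC 1 t s).comp ((S.Om t s).comp (S.PE t 0 s)))) +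
    (∫ s in (0:ℝ)..1, ∫ t in (0:ℝ)..1,
        (S'.PC 1 t s).comp ((S'.Om t s).comp ((S'.PE t 0 s).comp (S.PE 1 0 s)))) =
    (S'.PC 1 0 0).comp S.hol + S'.hol.comp (S.PE 1 0 1) := by
  have hh := S.continuous_holDensity
  have hh' := S'.continuous_holDensity
  have hp' : Continuous fun s => S'.PC 1 0 s :=
    continuous_iff_continuousAt.2 fun s => (S'.hPsC 1 0 s).continuousAt
  have hg : Continuous fun s => S.PE 1 0 s :=
    continuous_iff_continuousAt.2 fun s => (S.hPsE 1 0 s).continuousAt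
  simp_rw [S.integral_comp_integrand, S'.integral_integrand_comp]
  have hi₁ := (hp'.clm_comp hh).intervalIntegrable (μ := volume) 0 1
  have hi₂ := (hh'.clm_comp hg).intervalIntegrable (μ := volume) 0 1
  have hi₃ := (hh'.clm_comp (continuous_const (y := S.PE 1 0 0))).intervalIntegrable
    (μ := volume) 0 1
  have hd : ∀ s ∈ Set.uIcc (0 : ℝ) 1,
      HasDerivAt (fun s => (S'.PC 1 0 s).comp (∫ u in (0 : ℝ)..s, S.holDensity u))
        ((S'.PC 1 0 s).comp (S.holDensity s) + (S'.holDensity s).comp (S.PE 1 0 s) -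
          (S'.holDensity s).comp (S.PE 1 0 0)) s := by
    intro s hs
    rw [Set.uIcc_of_le zero_le_one] at hs
    convert (S'.hPsC 1 0 s).clm_comp (hh.integral_hasStrictDerivAt 0 s).hasDerivAt using 1
    rw [S'.PsC_eq hs, ContinuousLinearMap.comp_assoc, S.comp_integral_holDensity hs,
      ContinuousLinearMap.comp_sub]
    abel
  have hftc := integral_eq_sub_of_hasDerivAt hd ((hi₁.add hi₂).sub hi₃)
  rw [integral_sub (hi₁.add hi₂) hi₃, integral_add hi₁ hi₂, integral_same,
    ContinuousLinearMap.comp_zero, sub_zero] at hftc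
  have hi₄ : ∫ s in (0 : ℝ)..1, (S'.holDensity s).comp (S.PE 1 0 0) =
      S'.hol.comp (S.PE 1 0 0) :=
    ((ContinuousLinearMap.compL ℝ E E C).flip (S.PE 1 0 0)).intervalIntegral_comp_comm
      (hh'.intervalIntegrable _ _)
  have hfold : ∫ u in (0 : ℝ)..1, S.holDensity u = S.hol := rfl
  have hend := S.comp_integral_holDensity (Set.right_mem_Icc.2 zero_le_one)
  rw [hfold] at hftc hend
  rw [hi₄, sub_eq_iff_eq_add] at hftc
  rw [hftc, ← sub_add_cancel (S'.PC 1 0 1) (S'.PC 1 0 0), ← S'.hol_comp,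
    ← sub_add_cancel (S.PE 1 0 1) (S.PE 1 0 0), ← hend, ContinuousLinearMap.add_comp,
    ContinuousLinearMap.comp_add, ContinuousLinearMap.comp_assoc]
  abel
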